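/- arXiv:1812.00653 — 3 statements merged into one kernel-verified Lean document; each statement's English description precedes it below -/
import Mathlib

section
/- Let V and Q be finite-dimensional real inner product spaces, D : V →ₗ[ℝ] Q a linear map, and G : Q →ₗ[ℝ] V a linear map satisfying ⟪G q, v⟫ = −⟪q, D v⟫ for all q ∈ Q, v ∈ V. Assume the inf-sup condition: there is β > 0 such that for every q ∈ Q there exists v ∈ V, v ≠ 0, with β · ‖q‖ · √(‖v‖² + ‖D v‖²) ≤ ⟪q, D v⟫. Then every v ∈ V can be written uniquely as v = G r + z with r ∈ Q and z ∈ ker D; moreover this decomposition is orthogonal: ⟪G r, z⟫ = 0. -/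
open scoped RealInnerProductSpace

/-- If `G` is minus the adjoint of `D`, the orthogonal complement of the range of `G` is the kernel
of `D`. -/
theorem orthogonal_range_eq_ker_of_inner_eq_neg
    {V Q : Type*} [NormedAddCommGroup V] [InnerProductSpace ℝ V]
    [NormedAddCommGroup Q] [InnerProductSpace ℝ Q]
    {D : V →ₗ[ℝ] Q} {G : Q →ₗ[ℝ] V} (hG : ∀ (q : Q) (v : V), ⟪G q, v⟫ = -⟪q, D v⟫) :
    (LinearMap.range G)ᗮ = LinearMap.ker D := by
  ext z
  rw [Submodule.mem_orthogonal, LinearMap.mem_ker]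
  constructor
  · intro h
    have h' := h (G (D z)) (LinearMap.mem_range_self G _)
    rw [hG, neg_eq_zero] at h'
    exact inner_self_eq_zero.mp h'
  · rintro h _ ⟨q, rfl⟩
    rw [hG, h, inner_zero_right, neg_zero]

/-- Under the inf-sup condition the discrete gradient is injective. -/
theorem injective_of_inner_eq_neg_of_infsup
    {V Q : Type*} [NormedAddCommGroup V] [InnerProductSpace ℝ V]
    [NormedAddCommGroup Q] [InnerProductSpace ℝ Q]
    {D : V →ₗ[ℝ] Q} {G : Q →ₗ[ℝ] V} (hG : ∀ (q : Q) (v : V), ⟪G q, v⟫ = -⟪q, D v⟫)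
    {β : ℝ} (hβ : 0 < β)
    (hinfsup : ∀ q : Q, ∃ v : V, v ≠ 0 ∧
      β * ‖q‖ * Real.sqrt (‖v‖ ^ 2 + ‖D v‖ ^ 2) ≤ ⟪q, D v⟫) :
    Function.Injective G := by
  rw [injective_iff_map_eq_zero]
  intro q hq
  obtain ⟨v, hv, h⟩ := hinfsup q
  have hqv : ⟪q, D v⟫ = 0 := by
    rw [← neg_eq_zero, ← hG, hq, inner_zero_left]
  rw [hqv] at h
  by_contra hne
  have hv' : 0 < ‖v‖ := norm_pos_iff.mpr hv
  have hq' : 0 < ‖q‖ := norm_pos_iff.mpr hne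
  have : 0 < β * ‖q‖ * Real.sqrt (‖v‖ ^ 2 + ‖D v‖ ^ 2) := by positivity
  exact this.not_ge h

/-- Discrete Helmholtz decomposition: under the inf-sup condition, every `v` can
be written uniquely as `v = G r + z` with `z ∈ ker D`, and the decomposition is
orthogonal: `⟪G r, z⟫ = 0`. -/
theorem discrete_helmholtz_decomposition
    {V Q : Type*} [NormedAddCommGroup V] [InnerProductSpace ℝ V] [FiniteDimensional ℝ V]
    [NormedAddCommGroup Q] [InnerProductSpace ℝ Q] [FiniteDimensional ℝ Q]
    (D : V →ₗ[ℝ] Q) (G : Q →ₗ[ℝ] V)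
    (hG : ∀ (q : Q) (v : V), ⟪G q, v⟫ = -⟪q, D v⟫)
    (β : ℝ) (hβ : 0 < β)
    (hinfsup : ∀ q : Q, ∃ v : V, v ≠ 0 ∧
      β * ‖q‖ * Real.sqrt (‖v‖ ^ 2 + ‖D v‖ ^ 2) ≤ ⟪q, D v⟫) :
    ∀ v : V, (∃! rz : Q × V, rz.2 ∈ LinearMap.ker D ∧ v = G rz.1 + rz.2) ∧
      (∀ (r : Q) (z : V), z ∈ LinearMap.ker D → v = G r + z → ⟪G r, z⟫ = 0) := by
  have hker := orthogonal_range_eq_ker_of_inner_eq_neg hG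
  have hinj := injective_of_inner_eq_neg_of_infsup hG hβ hinfsup
  have horth : ∀ (r : Q) (z : V), z ∈ LinearMap.ker D → ⟪G r, z⟫ = 0 := fun r z hz => by
    rw [hG, LinearMap.mem_ker.mp hz, inner_zero_right, neg_zero]
  intro v
  refine ⟨?_, fun r z hz _ => horth r z hz⟩
  obtain ⟨_, ⟨r, rfl⟩, z, hz, hv⟩ := (LinearMap.range G).exists_add_mem_mem_orthogonal v
  rw [hker] at hz
  refine ⟨(r, z), ⟨hz, hv⟩, ?_⟩
  rintro ⟨r', z'⟩ ⟨hz', hv'⟩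
  have hdiff : G (r' - r) = z - z' := by
    rw [map_sub, sub_eq_sub_iff_add_eq_add, ← hv', hv, add_comm]
  have hzero : G (r' - r) = 0 := by
    have h := horth (r' - r) (z - z') (sub_mem hz hz')
    rw [← hdiff] at h
    exact inner_self_eq_zero.mp h
  have hr : r' = r := hinj (by rwa [map_sub, sub_eq_zero] at hzero)
  have hzz : z' = z := (sub_eq_zero.mp (hdiff.symm.trans hzero)).symm
  rw [hr, hzz]
end

section
/- Let V and Q be finite-dimensional real inner product spaces, D : V →ₗ[ℝ] Q a linear map, and G : Q →ₗ[ℝ] V a linear map satisfying ⟪G q, v⟫ = −⟪q, D v⟫ for all q ∈ Q, v ∈ V. Assume the inf-sup condition: there is β > 0 such that for every q ∈ Q there exists w ∈ V, w ≠ 0, with β · ‖q‖ · √(‖w‖² + ‖D w‖²) ≤ ⟪q, D w⟫. Suppose v ∈ V decomposes as v = G r + z with r ∈ Q and z ∈ ker D. Then β · ‖r‖ ≤ sSup { ⟪v, w⟫ : w ∈ V, ‖w‖² + ‖D w‖² ≤ 1 }. -/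
open scoped RealInnerProductSpace

/-- If `v = G r + z` with `z ∈ ker D`, then under the inf-sup condition the
lifting satisfies `β ‖r‖ ≤ sup { ⟪v, w⟫ : ‖w‖² + ‖D w‖² ≤ 1 }`, i.e.
`‖Θ_h v‖ ≤ β⁻¹ ‖v‖_{(H(div))'}`. -/
theorem lifting_dual_bound
    {V Q : Type*} [NormedAddCommGroup V] [InnerProductSpace ℝ V] [FiniteDimensional ℝ V]
    [NormedAddCommGroup Q] [InnerProductSpace ℝ Q] [FiniteDimensional ℝ Q]
    (D : V →ₗ[ℝ] Q) (G : Q →ₗ[ℝ] V)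
    (hG : ∀ (q : Q) (v : V), ⟪G q, v⟫ = -⟪q, D v⟫)
    (β : ℝ) (hβ : 0 < β)
    (hinfsup : ∀ q : Q, ∃ w : V, w ≠ 0 ∧
      β * ‖q‖ * Real.sqrt (‖w‖ ^ 2 + ‖D w‖ ^ 2) ≤ ⟪q, D w⟫)
    (v : V) (r : Q) (z : V) (hz : z ∈ LinearMap.ker D) (hdecomp : v = G r + z) :
    β * ‖r‖ ≤ sSup {s : ℝ | ∃ w : V, ‖w‖ ^ 2 + ‖D w‖ ^ 2 ≤ 1 ∧ s = ⟪v, w⟫} := by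
  have bdd : BddAbove {s : ℝ | ∃ w : V, ‖w‖ ^ 2 + ‖D w‖ ^ 2 ≤ 1 ∧ s = ⟪v, w⟫} := by
    refine ⟨‖v‖, ?_⟩
    rintro _ ⟨w, hw, rfl⟩
    have hw1 : ‖w‖ ≤ 1 := by nlinarith [norm_nonneg w, sq_nonneg ‖D w‖]
    exact (real_inner_le_norm v w).trans (mul_le_of_le_one_right (norm_nonneg v) hw1)
  obtain ⟨w, hw0, hw⟩ := hinfsup r
  set N := Real.sqrt (‖w‖ ^ 2 + ‖D w‖ ^ 2) with hN
  have hN0 : 0 < N := Real.sqrt_pos.2 (by have := norm_pos_iff.2 hw0; positivity)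
  have hNsq : N ^ 2 = ‖w‖ ^ 2 + ‖D w‖ ^ 2 := Real.sq_sqrt (by positivity)
  -- Removing the `ker D` component of `w` keeps `D w` and does not increase the norm.
  set p := (LinearMap.ker D)ᗮ.starProjection w with hp
  have hpD : D p = D w := by
    have h : w - p ∈ LinearMap.ker D := by simp [hp]
    rw [LinearMap.mem_ker, map_sub, sub_eq_zero] at h
    exact h.symm
  have hpn : ‖p‖ ≤ ‖w‖ := (LinearMap.ker D)ᗮ.norm_starProjection_apply_le w
  have hzp : ⟪z, p⟫ = 0 :=
    Submodule.inner_right_of_mem_orthogonal hz ((LinearMap.ker D)ᗮ.starProjection_apply_mem w)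
  have hvp : ⟪v, -N⁻¹ • p⟫ = ⟪r, D w⟫ / N := by
    rw [hdecomp, inner_smul_right, inner_add_left, hG, hzp, hpD]
    ring
  calc
    β * ‖r‖ ≤ ⟪v, -N⁻¹ • p⟫ := by rwa [hvp, le_div_iff₀ hN0]
    _ ≤ _ := by
      refine le_csSup bdd ⟨-N⁻¹ • p, ?_, rfl⟩
      rw [map_smul, hpD, norm_smul, norm_smul, norm_neg, norm_inv, Real.norm_of_nonneg hN0.le]
      calc
        (N⁻¹ * ‖p‖) ^ 2 + (N⁻¹ * ‖D w‖) ^ 2 = (‖p‖ ^ 2 + ‖D w‖ ^ 2) / N ^ 2 := by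
          field_simp
        _ ≤ 1 := by
          rw [div_le_one (by positivity), hNsq]
          gcongr
end

section
/- Let V and Q be finite-dimensional real inner product spaces, D : V →ₗ[ℝ] Q a linear map, and G : Q →ₗ[ℝ] V a linear map satisfying ⟪G q, v⟫ = −⟪q, D v⟫ for all q ∈ Q, v ∈ V. Let K > 0. Then for every v ∈ V and every q₀, φ ∈ Q: ⟪D v, q₀ + φ⟫ ≤ √( K⁻¹ · ‖v‖² + ‖D v‖² ) · √( ‖q₀‖² + K · ‖G φ‖² ). -/
open scoped RealInnerProductSpace

/-- K-uniform boundedness (with constant 1) of the form `b(v, q) = ⟪D v, q⟫`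
with respect to the weighted flux norm and the weighted sum-space pressure norm:
`⟪D v, q₀ + φ⟫ ≤ √(K⁻¹‖v‖² + ‖D v‖²) · √(‖q₀‖² + K‖G φ‖²)`. -/
theorem b_form_bounded_weighted
    {V Q : Type*} [NormedAddCommGroup V] [InnerProductSpace ℝ V] [FiniteDimensional ℝ V]
    [NormedAddCommGroup Q] [InnerProductSpace ℝ Q] [FiniteDimensional ℝ Q]
    (D : V →ₗ[ℝ] Q) (G : Q →ₗ[ℝ] V)
    (hG : ∀ (q : Q) (v : V), ⟪G q, v⟫ = -⟪q, D v⟫)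
    (K : ℝ) (hK : 0 < K) :
    ∀ (v : V) (q₀ φ : Q),
      ⟪D v, q₀ + φ⟫ ≤ Real.sqrt (K⁻¹ * ‖v‖ ^ 2 + ‖D v‖ ^ 2) *
        Real.sqrt (‖q₀‖ ^ 2 + K * ‖G φ‖ ^ 2) := by
  intro v q₀ φ
  have h₀ : ⟪D v, q₀⟫ ≤ ‖D v‖ * ‖q₀‖ := real_inner_le_norm _ _
  have h₁ : ⟪D v, φ⟫ ≤ ‖G φ‖ * ‖v‖ := by
    have h : ⟪D v, φ⟫ = -⟪G φ, v⟫ := by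
      rw [hG, neg_neg, real_inner_comm]
    rw [h]
    exact (neg_le_abs _).trans (abs_real_inner_le_norm _ _)
  rw [inner_add_right, ← Real.sqrt_mul (by positivity)]
  refine (add_le_add h₀ h₁).trans (Real.le_sqrt_of_sq_le ?_)
  have key : (K⁻¹ * ‖v‖ ^ 2 + ‖D v‖ ^ 2) * (‖q₀‖ ^ 2 + K * ‖G φ‖ ^ 2)
      - (‖D v‖ * ‖q₀‖ + ‖G φ‖ * ‖v‖) ^ 2
      = K⁻¹ * (‖v‖ * ‖q₀‖ - K * ‖D v‖ * ‖G φ‖) ^ 2 := by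
    field_simp
    ring
  have hnonneg : 0 ≤ K⁻¹ * (‖v‖ * ‖q₀‖ - K * ‖D v‖ * ‖G φ‖) ^ 2 := by positivity
  linarith
end
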